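/- Let D be the N×N matrix with rows indexed by θ ∈ θ_p and columns by θ' ∈ θ_a given by D_{θ,θ'} = e^{−i(l−1/2)(θ−θ')}/(2iN·sin((θ'−θ)/2)) · (√(b_{θ'})/√(b_θ) + √(b_θ)/√(b_{θ'})). Then D is invertible and, for θ ∈ θ_a and θ' ∈ θ_p, (D^{−1})_{θ,θ'} = i·e^{−i(l−1/2)(θ−θ')} · e^{(ν_θ−ν_{θ'})/2} / (N·√(sinh γ_θ · sinh γ_{θ'})) · sinh((γ_θ+γ_{θ'})/2)/sin((θ−θ')/2). -/

import Mathlib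

open Finset

noncomputable section

/-- Antiperiodic momenta: θ_a = {(2j−1)π/N : j = 1,…,N}. -/
def thetaA (N : ℕ) (j : Fin N) : ℝ := (2 * (j : ℝ) + 1) * Real.pi / N

/-- Periodic momenta: θ_p = {2(j−1)π/N : j = 1,…,N}. -/
def thetaP (N : ℕ) (j : Fin N) : ℝ := (2 * (j : ℝ)) * Real.pi / N

/-- b_θ, the principal square root of
`(1−αe^{iθ})(1−βe^{−iθ}) / ((1−βe^{iθ})(1−αe^{−iθ}))`. -/
def bfun (α β θ : ℝ) : ℂ :=
  ((((1 : ℂ) - (α : ℂ) * Complex.exp (Complex.I * θ)) *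
      ((1 : ℂ) - (β : ℂ) * Complex.exp (-Complex.I * θ))) /
    (((1 : ℂ) - (β : ℂ) * Complex.exp (Complex.I * θ)) *
      ((1 : ℂ) - (α : ℂ) * Complex.exp (-Complex.I * θ)))) ^ ((2 : ℂ)⁻¹)

/-- √(b_θ), principal square root. -/
def sqb (α β θ : ℝ) : ℂ := bfun α β θ ^ ((2 : ℂ)⁻¹)

/-- The matrix D, rows indexed by θ ∈ θ_p, columns by θ' ∈ θ_a. -/
def Dmat (N : ℕ) (l : ℤ) (α β : ℝ) : Matrix (Fin N) (Fin N) ℂ :=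
  Matrix.of fun j k =>
    Complex.exp (-Complex.I * ((l : ℂ) - 2⁻¹) * ((thetaP N j : ℝ) - (thetaA N k : ℝ))) /
        (2 * Complex.I * N * Complex.sin ((((thetaA N k : ℝ) : ℂ) - (thetaP N j : ℝ)) / 2)) *
      (sqb α β (thetaA N k) / sqb α β (thetaP N j) +
        sqb α β (thetaP N j) / sqb α β (thetaA N k))

/-- ν_θ = ln [∏_{θ'∈θ_a} sinh((γ_θ+γ_{θ'})/2) / ∏_{θ'∈θ_p} sinh((γ_θ+γ_{θ'})/2)]. -/
def nufun (N : ℕ) (γ : ℝ → ℝ) (θ : ℝ) : ℝ :=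
  Real.log ((∏ j : Fin N, Real.sinh ((γ θ + γ (thetaA N j)) / 2)) /
    (∏ j : Fin N, Real.sinh ((γ θ + γ (thetaP N j)) / 2)))

/-- A real function of the form `e^{-inx/2} P(e^{ix})` with `P` a polynomial of degree at most `n`:
a trigonometric polynomial of degree at most `n / 2` whose frequencies are congruent to `n / 2`
modulo one. -/
def IsTrigPoly (n : ℕ) (f : ℝ → ℝ) : Prop :=
  ∃ P : Polynomial ℂ, P.natDegree ≤ n ∧
    ∀ x : ℝ, (f x : ℂ) =
      Complex.exp (-(n * x / 2) * Complex.I) * P.eval (Complex.exp (x * Complex.I))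

namespace IsTrigPoly

lemma add {n : ℕ} {f g : ℝ → ℝ} (hf : IsTrigPoly n f) (hg : IsTrigPoly n g) :
    IsTrigPoly n (fun x => f x + g x) := by
  obtain ⟨P, hP, hP'⟩ := hf
  obtain ⟨Q, hQ, hQ'⟩ := hg
  refine ⟨P + Q, Polynomial.natDegree_add_le_of_degree_le hP hQ, fun x => ?_⟩
  rw [Complex.ofReal_add, hP', hQ', Polynomial.eval_add, mul_add]

lemma mul {m n : ℕ} {f g : ℝ → ℝ} (hf : IsTrigPoly m f) (hg : IsTrigPoly n g) :
    IsTrigPoly (m + n) (fun x => f x * g x) := by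
  obtain ⟨P, hP, hP'⟩ := hf
  obtain ⟨Q, hQ, hQ'⟩ := hg
  refine ⟨P * Q, Polynomial.natDegree_mul_le_of_le hP hQ, fun x => ?_⟩
  have : Complex.exp (-(((m + n : ℕ) : ℂ) * x / 2) * Complex.I) =
      Complex.exp (-(m * x / 2) * Complex.I) * Complex.exp (-(n * x / 2) * Complex.I) := by
    rw [← Complex.exp_add]; congr 1; push_cast; ring
  rw [Complex.ofReal_mul, hP', hQ', Polynomial.eval_mul, this]
  ring

lemma const (a : ℝ) : IsTrigPoly 0 (fun _ => a) :=
  ⟨Polynomial.C (a : ℂ), by simp, fun x => by simp⟩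

lemma const_mul {n : ℕ} {f : ℝ → ℝ} (a : ℝ) (hf : IsTrigPoly n f) :
    IsTrigPoly n (fun x => a * f x) := by
  simpa using (const a).mul hf

lemma sin_add_half (a : ℝ) : IsTrigPoly 1 (fun x => Real.sin ((x + a) / 2)) := by
  refine ⟨Polynomial.C (-Complex.I / 2 * Complex.exp (a / 2 * Complex.I)) * Polynomial.X +
    Polynomial.C (Complex.I / 2 * Complex.exp (-(a / 2 * Complex.I))),
    Polynomial.natDegree_linear_le, fun x => ?_⟩
  have h1 : Complex.exp (x * Complex.I) = Complex.exp (x / 2 * Complex.I) ^ 2 := by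
    rw [← Complex.exp_nat_mul]; congr 1; push_cast; ring
  have h2 : Complex.exp (-(((1 : ℕ) : ℂ) * x / 2) * Complex.I) =
      (Complex.exp (x / 2 * Complex.I))⁻¹ := by
    rw [← Complex.exp_neg]; congr 1; push_cast; ring
  have h3 : Complex.exp (((x : ℂ) + a) / 2 * Complex.I) =
      Complex.exp (x / 2 * Complex.I) * Complex.exp (a / 2 * Complex.I) := by
    rw [← Complex.exp_add]; congr 1; ring
  have := Complex.exp_ne_zero (x / 2 * Complex.I)
  have := Complex.exp_ne_zero (a / 2 * Complex.I)
  simp only [Polynomial.eval_add, Polynomial.eval_mul, Polynomial.eval_C, Polynomial.eval_X]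
  rw [h2]
  push_cast
  rw [Complex.sin, neg_mul, Complex.exp_neg, h3, h1, Complex.exp_neg]
  field_simp
  ring

lemma cos : IsTrigPoly 2 Real.cos := by
  have h := ((sin_add_half Real.pi).mul (sin_add_half Real.pi)).add
    (((sin_add_half 0).mul (sin_add_half 0)).const_mul (-1))
  convert h using 2 with x
  have e : (x + Real.pi) / 2 = x / 2 + Real.pi / 2 := by ring
  have : x = 2 * (x / 2) := by ring
  rw [e, Real.sin_add_pi_div_two, add_zero]
  conv_lhs => rw [this, Real.cos_two_mul']
  ring

lemma sin : IsTrigPoly 2 Real.sin := by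
  convert ((sin_add_half 0).mul (sin_add_half Real.pi)).const_mul 2 using 2 with x
  have e : (x + Real.pi) / 2 = x / 2 + Real.pi / 2 := by ring
  have : x = 2 * (x / 2) := by ring
  rw [e, Real.sin_add_pi_div_two, add_zero]
  conv_lhs => rw [this, Real.sin_two_mul]
  ring

lemma const_two (a : ℝ) : IsTrigPoly 2 (fun _ => a) := by
  have h := (((sin_add_half Real.pi).mul (sin_add_half Real.pi)).add
      ((sin_add_half 0).mul (sin_add_half 0))).const_mul a
  convert h using 2 with x
  have e : (x + Real.pi) / 2 = x / 2 + Real.pi / 2 := by ring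
  rw [e, Real.sin_add_pi_div_two, add_zero]
  linear_combination (-a) * Real.sin_sq_add_cos_sq (x / 2)

end IsTrigPoly

lemma Lagrange.nodal_range_pow_eq {M : ℕ} (hM : 0 < M) {ζ : ℂ} (hζ : IsPrimitiveRoot ζ M) :
    Lagrange.nodal (range M) (fun k => ζ ^ k) = Polynomial.X ^ M - 1 := by
  have := X_pow_sub_C_eq_prod hζ hM (one_pow M : (1 : ℂ) ^ M = 1)
  rw [map_one] at this
  rw [this, Lagrange.nodal_eq]
  simp

/-- Lagrange interpolation at the `M`-th roots of unity. -/
lemma sum_roots_of_unity_interpolation {M : ℕ} (hM : 0 < M) {ζ : ℂ} (hζ : IsPrimitiveRoot ζ M)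
    {P : Polynomial ℂ} (hP : P.degree < M) {z : ℂ} (hz : z ^ M ≠ 1) :
    ∑ k ∈ range M, ζ ^ k * P.eval (ζ ^ k) / (z - ζ ^ k) = M * P.eval z / (z ^ M - 1) := by
  have hinj : Set.InjOn (fun k => ζ ^ k) (range M : Set ℕ) := by
    intro a ha b hb h
    exact hζ.pow_inj (by simpa using ha) (by simpa using hb) h
  have hpow : ∀ k : ℕ, (ζ ^ k) ^ M = 1 := fun k => by
    rw [← pow_mul, mul_comm, pow_mul, hζ.pow_eq_one, one_pow]
  have hne : ∀ k ∈ range M, z ≠ ζ ^ k := by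
    rintro k - rfl
    exact hz (hpow k)
  have hP' := Lagrange.eq_interpolate (s := range M) hinj (by simpa using hP)
  have h := Lagrange.eval_interpolate_not_at_node (r := fun k => P.eval (ζ ^ k)) hne
  rw [← hP', Lagrange.nodal_range_pow_eq hM hζ] at h
  have hw : ∀ k ∈ range M, Lagrange.nodalWeight (range M) (fun k => ζ ^ k) k = ζ ^ k / M := by
    intro k hk
    have h0 : ζ ^ k ≠ 0 := pow_ne_zero _ (hζ.ne_zero hM.ne')
    have h1 : (ζ ^ k) ^ (M - 1) * ζ ^ k = 1 := by
      rw [← pow_succ, Nat.sub_add_cancel hM, hpow]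
    have hM' : (M : ℂ) ≠ 0 := by exact_mod_cast hM.ne'
    rw [Lagrange.nodalWeight_eq_eval_derivative_nodal hk, Lagrange.nodal_range_pow_eq hM hζ]
    simp only [Polynomial.derivative_sub, Polynomial.derivative_X_pow, Polynomial.derivative_one,
      sub_zero, Polynomial.eval_mul, Polynomial.eval_pow, Polynomial.eval_X,
      Polynomial.eval_natCast, map_natCast]
    rw [inv_eq_iff_eq_inv, inv_div, eq_div_iff h0, mul_assoc, h1, mul_one]
  have hz' : z ^ M - 1 ≠ 0 := sub_ne_zero.2 hz
  have hM' : (M : ℂ) ≠ 0 := by exact_mod_cast hM.ne'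
  rw [h, sum_congr (g := fun k => ζ ^ k / M * (z - ζ ^ k)⁻¹ * P.eval (ζ ^ k)) rfl
    (fun k hk => congrArg (fun y => y * (z - ζ ^ k)⁻¹ * P.eval (ζ ^ k)) (hw k hk))]
  simp only [Polynomial.eval_sub, Polynomial.eval_pow, Polynomial.eval_X, Polynomial.eval_one]
  rw [eq_div_iff hz', sum_mul, mul_sum, mul_sum]
  refine sum_congr rfl fun k hk => ?_
  have : z - ζ ^ k ≠ 0 := sub_ne_zero.2 (hne k hk)
  field_simp

lemma sum_range_two_mul {α : Type*} [AddCommMonoid α] (f : ℕ → α) (N : ℕ) :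
    ∑ k ∈ range (2 * N), f k = ∑ i : Fin N, f (2 * i) + ∑ i : Fin N, f (2 * i + 1) := by
  rw [Fin.sum_univ_eq_sum_range (fun i => f (2 * i)),
    Fin.sum_univ_eq_sum_range (fun i => f (2 * i + 1)), ← sum_add_distrib]
  induction N with
  | zero => simp
  | succ n ih => rw [mul_add, mul_one, sum_range_succ, sum_range_succ, ih, sum_range_succ, add_assoc]

lemma prod_range_two_mul {α : Type*} [CommMonoid α] (f : ℕ → α) (N : ℕ) :
    ∏ k ∈ range (2 * N), f k = (∏ i : Fin N, f (2 * i)) * ∏ i : Fin N, f (2 * i + 1) :=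
  sum_range_two_mul (α := Additive α) f N

lemma IsTrigPoly.sum_interpolation {N : ℕ} (hN : 0 < N) {f : ℝ → ℝ}
    (hf : IsTrigPoly (2 * N - 1) f) {t : ℝ} (ht : Real.sin (N * t) ≠ 0) :
    ∑ k ∈ range (2 * N), (-1) ^ k * f (k * Real.pi / N) / Real.sin ((t - k * Real.pi / N) / 2) =
      2 * N * f t / Real.sin (N * t) := by
  obtain ⟨P, hP, hPf⟩ := hf
  have hM : 0 < 2 * N := by omega
  have hNC : (N : ℂ) ≠ 0 := by exact_mod_cast hN.ne'
  have hζ := Complex.isPrimitiveRoot_exp (2 * N) hM.ne'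
  set ζ := Complex.exp (2 * Real.pi * Complex.I / ((2 * N : ℕ) : ℂ)) with hζdef
  set w := Complex.exp (t / 2 * Complex.I) with hw
  have hw0 : w ≠ 0 := Complex.exp_ne_zero _
  have hz : Complex.exp (t * Complex.I) = w ^ 2 := by
    rw [hw, ← Complex.exp_nat_mul]; congr 1; push_cast; ring
  have hzN : Complex.exp (t * Complex.I) ^ (2 * N) - 1 =
      2 * Complex.I * w ^ (2 * N) * (Real.sin (N * t) : ℂ) := by
    have : Complex.exp (((N * t : ℝ) : ℂ) * Complex.I) = w ^ (2 * N) := by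
      rw [hw, ← Complex.exp_nat_mul]; congr 1; push_cast; ring
    rw [Complex.ofReal_sin, Complex.sin, neg_mul, Complex.exp_neg, this, hz]
    field_simp
    linear_combination (w ^ (2 * N * 2) - 1) * Complex.I_sq
  have hz1 : Complex.exp (t * Complex.I) ^ (2 * N) ≠ 1 := by
    rw [← sub_ne_zero, hzN]
    have : (Real.sin (N * t) : ℂ) ≠ 0 := by exact_mod_cast ht
    exact mul_ne_zero (mul_ne_zero (by simp) (pow_ne_zero _ hw0)) this
  have hdeg : P.degree < (2 * N : ℕ) :=
    lt_of_le_of_lt Polynomial.degree_le_natDegree (by exact_mod_cast (by omega))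
  have key := sum_roots_of_unity_interpolation hM hζ hdeg hz1
  have hsum : ∀ k ∈ range (2 * N),
      (((-1) ^ k * f (k * Real.pi / N) / Real.sin ((t - k * Real.pi / N) / 2) : ℝ) : ℂ) =
        2 * Complex.I * w * (ζ ^ k * P.eval (ζ ^ k) / (Complex.exp (t * Complex.I) - ζ ^ k)) := by
    intro k hk
    set v := Complex.exp (((k * Real.pi / N : ℝ) : ℂ) / 2 * Complex.I) with hv
    have hv0 : v ≠ 0 := Complex.exp_ne_zero _
    have hζk : ζ ^ k = v ^ 2 := by
      rw [hζdef, hv, ← Complex.exp_nat_mul, ← Complex.exp_nat_mul]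
      congr 1; push_cast; field_simp
    have hvN : Complex.exp (-(((2 * N - 1 : ℕ) : ℂ) * ((k * Real.pi / N : ℝ) : ℂ) / 2) * Complex.I)
        = (-1) ^ k * v := by
      rw [← Complex.exp_pi_mul_I, ← Complex.exp_nat_mul, ← inv_inv (Complex.exp _),
        ← Complex.exp_neg, hv, ← Complex.exp_neg, ← Complex.exp_add,
        Complex.exp_eq_exp_iff_exists_int]
      refine ⟨-k, ?_⟩
      rw [Nat.cast_sub (by omega)]
      push_cast
      field_simp
      ring
    have hsin : ((Real.sin ((t - k * Real.pi / N) / 2) : ℝ) : ℂ) =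
        (w ^ 2 - v ^ 2) / (2 * Complex.I * w * v) := by
      have : Complex.exp ((((t - k * Real.pi / N) / 2 : ℝ) : ℂ) * Complex.I) = w / v := by
        rw [hw, hv, ← Complex.exp_sub]; congr 1; push_cast; ring
      rw [Complex.ofReal_sin, Complex.sin, neg_mul, Complex.exp_neg, this]
      field_simp
      linear_combination (v ^ 2 - w ^ 2) * Complex.I_sq
    have hne : w ^ 2 - v ^ 2 ≠ 0 := by
      rw [← hz, ← hζk, sub_ne_zero]
      intro h
      apply hz1
      rw [h, ← pow_mul, mul_comm, pow_mul, hζ.pow_eq_one, one_pow]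
    have hexp : Complex.exp (((k * Real.pi / N : ℝ) : ℂ) * Complex.I) = v ^ 2 := by
      rw [hv, ← Complex.exp_nat_mul]; congr 1; push_cast; ring
    rw [Complex.ofReal_div, Complex.ofReal_mul, hPf, hsin, hvN, hexp, hζk, hz]
    have h1 : ((-1 : ℂ) ^ k) * (-1) ^ k = 1 := by rw [← mul_pow]; simp
    push_cast
    field_simp
    linear_combination P.eval (v ^ 2) * h1
  have hC : ((∑ k ∈ range (2 * N), (-1) ^ k * f (k * Real.pi / N) /
      Real.sin ((t - k * Real.pi / N) / 2) : ℝ) : ℂ) =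
      ((2 * N * f t / Real.sin (N * t) : ℝ) : ℂ) := by
    rw [Complex.ofReal_sum, sum_congr rfl hsum, ← mul_sum, key, hzN, Complex.ofReal_div,
      Complex.ofReal_mul, hPf]
    have : Complex.exp (-(((2 * N - 1 : ℕ) : ℂ) * t / 2) * Complex.I) * w ^ (2 * N) = w := by
      rw [hw, ← Complex.exp_nat_mul, ← Complex.exp_add, Nat.cast_sub (by omega)]
      congr 1; push_cast; ring
    have hs : (Real.sin (N * t) : ℂ) ≠ 0 := by exact_mod_cast ht
    push_cast at hs ⊢
    generalize Complex.exp (-(((2 * N - 1 : ℕ) : ℂ) * t / 2) * Complex.I) = E at this ⊢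
    generalize P.eval (Complex.exp (t * Complex.I)) = p
    field_simp
    linear_combination (-p) * this
  exact_mod_cast hC

lemma exists_prod_cos_sub_cos {N : ℕ} (hN : 0 < N) :
    ∃ κ : ℝ, κ ≠ 0 ∧ ∀ x : ℝ,
      ∏ i : Fin N, (Real.cos (thetaP N i) - Real.cos x) = κ * Real.sin (N * x / 2) ^ 2 := by
  refine ⟨-4 * (-1 / 2) ^ N, by positivity, fun x => ?_⟩
  have hNC : (N : ℂ) ≠ 0 := by exact_mod_cast hN.ne'
  have hζ := Complex.isPrimitiveRoot_exp N hN.ne'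
  set ζ := Complex.exp (2 * Real.pi * Complex.I / N) with hζdef
  have hζ0 : ζ ≠ 0 := Complex.exp_ne_zero _
  set v := Complex.exp (x / 2 * Complex.I) with hv
  have hv0 : v ≠ 0 := Complex.exp_ne_zero _
  have hz : Complex.exp (x * Complex.I) = v ^ 2 := by
    rw [hv, ← Complex.exp_nat_mul]; congr 1; push_cast; ring
  have hnodal : ∀ y : ℂ, ∏ i ∈ range N, (y - ζ ^ i) = y ^ N - 1 := fun y => by
    rw [← Lagrange.eval_nodal, Lagrange.nodal_range_pow_eq hN hζ]; simp
  have hprod : (-1) ^ N * ∏ i ∈ range N, ζ ^ i = -1 := by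
    have h := hnodal 0
    simp only [zero_sub, zero_pow hN.ne'] at h
    rwa [prod_congr rfl (fun i _ => (neg_one_mul (ζ ^ i)).symm), prod_mul_distrib,
      prod_const, card_range] at h
  have hfac : ∀ i ∈ range N, ((Real.cos (2 * i * Real.pi / N) - Real.cos x : ℝ) : ℂ) =
      (1 / 2) * ((v ^ 2 - ζ ^ i) * ((v ^ 2)⁻¹ - ζ ^ i)) / ζ ^ i := by
    intro i _
    have hi : Complex.exp (((2 * i * Real.pi / N : ℝ) : ℂ) * Complex.I) = ζ ^ i := by
      rw [hζdef, ← Complex.exp_nat_mul]; congr 1; push_cast; field_simp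
    rw [Complex.ofReal_sub, Complex.ofReal_cos, Complex.ofReal_cos, Complex.cos, Complex.cos,
      neg_mul, neg_mul, Complex.exp_neg, Complex.exp_neg, hi, hz]
    have : ζ ^ i ≠ 0 := pow_ne_zero _ hζ0
    field_simp
    ring
  have hsin : (Real.sin (N * x / 2) : ℂ) ^ 2 = -(1 / 4) * ((v ^ N) ^ 2 - 1) ^ 2 / (v ^ N) ^ 2 := by
    have : Complex.exp (((N * x / 2 : ℝ) : ℂ) * Complex.I) = v ^ N := by
      rw [hv, ← Complex.exp_nat_mul]; congr 1; push_cast; ring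
    rw [Complex.ofReal_sin, Complex.sin, neg_mul, Complex.exp_neg, this]
    have : v ^ N ≠ 0 := pow_ne_zero _ hv0
    field_simp
    rw [Complex.I_sq]
    ring
  have hC : ((∏ i ∈ range N, (Real.cos (2 * i * Real.pi / N) - Real.cos x) : ℝ) : ℂ) =
      ((-4 * (-1 / 2) ^ N * Real.sin (N * x / 2) ^ 2 : ℝ) : ℂ) := by
    rw [Complex.ofReal_prod, prod_congr rfl hfac, prod_div_distrib, prod_mul_distrib,
      prod_mul_distrib, hnodal, hnodal, prod_const, card_range, Complex.ofReal_mul,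
      Complex.ofReal_pow (Real.sin _), hsin]
    have hinv : (∏ i ∈ range N, ζ ^ i)⁻¹ = -(-1) ^ N := by
      exact inv_eq_of_mul_eq_one_right (by linear_combination -hprod)
    rw [div_eq_mul_inv _ (∏ i ∈ range N, ζ ^ i), hinv]
    have : v ^ N ≠ 0 := pow_ne_zero _ hv0
    have h2 : (-1 / 2 : ℂ) ^ N = (-1) ^ N * (1 / 2) ^ N := by rw [← mul_pow]; ring
    push_cast
    rw [h2, ← pow_mul, ← pow_mul, inv_pow, ← pow_mul, mul_comm N 2]
    field_simp
    ring
  have := Complex.ofReal_injective hC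
  rw [← this, ← Fin.prod_univ_eq_prod_range
    (fun i : ℕ => Real.cos (2 * i * Real.pi / N) - Real.cos x)]
  rfl

section Dispersion

variable {γ : ℝ → ℝ} {a c : ℝ}

lemma sinh_half_add_mul_sinh_half_sub (u v w : ℝ) :
    Real.sinh ((w + u) / 2) * Real.sinh ((w - v) / 2) =
      (Real.cosh w * Real.cosh ((u - v) / 2) + Real.sinh w * Real.sinh ((u - v) / 2) -
        Real.cosh ((u + v) / 2)) / 2 := by
  rw [← Real.cosh_add]
  have h1 : w + (u - v) / 2 = (w + u) / 2 + (w - v) / 2 := by ring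
  have h2 : (u + v) / 2 = (w + u) / 2 - (w - v) / 2 := by ring
  rw [h1, h2, Real.cosh_add, Real.cosh_sub]
  ring

/-- A product of `2n` half-angle hyperbolic sines splits into a part even in `γ` and `sinh γ` times
another even part, both trigonometric polynomials of controlled degree. -/
lemma exists_even_odd_parts (hγ : ∀ x, Real.cosh (γ x) = a - c * Real.cos x) {n : ℕ}
    (u v : Fin n → ℝ) :
    ∃ A B : ℝ → ℝ, IsTrigPoly (2 * n) A ∧
      (∀ k g, IsTrigPoly (k + 2) g → IsTrigPoly (2 * n + k) (fun x => g x * B x)) ∧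
      (∀ x, ∏ i, Real.sinh ((γ x + u i) / 2) * Real.sinh ((γ x - v i) / 2) =
        A x + Real.sinh (γ x) * B x) ∧
      ∀ x, ∏ i, Real.sinh ((-γ x + u i) / 2) * Real.sinh ((-γ x - v i) / 2) =
        A x - Real.sinh (γ x) * B x := by
  have hcosh : IsTrigPoly 2 (fun x => Real.cosh (γ x)) := by
    have := (IsTrigPoly.const_two a).add (IsTrigPoly.cos.const_mul (-c))
    convert this using 2 with x
    rw [hγ]; ring
  have hsinh : IsTrigPoly 4 (fun x => Real.sinh (γ x) * Real.sinh (γ x)) := by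
    have := (hcosh.mul hcosh).add (((IsTrigPoly.const_two 1).mul (IsTrigPoly.const_two 1)).const_mul
      (-1))
    convert this using 2 with x
    linear_combination -Real.cosh_sq (γ x)
  induction n with
  | zero =>
    refine ⟨fun _ => 1, fun _ => 0, IsTrigPoly.const 1, fun k g _ => ?_, by simp, by simp⟩
    exact ⟨0, by simp, by simp⟩
  | succ n ih =>
    obtain ⟨A, B, hA, hB, h1, h2⟩ := ih (fun i => u i.succ) (fun i => v i.succ)
    set r : ℝ → ℝ := fun x =>
      Real.cosh ((u 0 - v 0) / 2) / 2 * Real.cosh (γ x) + -Real.cosh ((u 0 + v 0) / 2) / 2 with hr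
    set d : ℝ := Real.sinh ((u 0 - v 0) / 2) / 2 with hd
    have hrp : IsTrigPoly 2 r := (hcosh.const_mul _).add (IsTrigPoly.const_two _)
    refine ⟨fun x => A x * r x + d * (Real.sinh (γ x) * Real.sinh (γ x) * B x),
      fun x => B x * r x + d * A x, ?_, fun k g hg => ?_, fun x => ?_, fun x => ?_⟩
    · exact (hA.mul hrp).add ((hB 2 _ hsinh).const_mul d)
    · have e1 := (hB k g hg).mul hrp
      have e2 := (hg.mul hA).const_mul d
      rw [show 2 * n + k + 2 = 2 * (n + 1) + k by ring] at e1
      rw [show k + 2 + 2 * n = 2 * (n + 1) + k by ring] at e2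
      convert e1.add e2 using 2 with x
      ring
    · rw [Fin.prod_univ_succ, h1, sinh_half_add_mul_sinh_half_sub, hr, hd]
      ring
    · rw [Fin.prod_univ_succ, h2, sinh_half_add_mul_sinh_half_sub, Real.cosh_neg, Real.sinh_neg,
        hr, hd]
      ring

lemma gamma_eq_of_cos_eq (hγ : ∀ x, Real.cosh (γ x) = a - c * Real.cos x) (hpos : ∀ x, 0 ≤ γ x)
    {x y : ℝ} (h : Real.cos x = Real.cos y) : γ x = γ y := by
  refine Real.cosh_strictMonoOn.injOn (hpos x) (hpos y) ?_
  simp only [hγ, h]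

/-- The interior points `kπ/(n+1)`, `0 < k < n+1`. -/
def thetaInterior (n : ℕ) (i : Fin n) : ℝ := ((i : ℝ) + 1) * Real.pi / (n + 1 : ℕ)

/-- The product over the interior points of `sinh((γ_x + γ_θ)/2)` times the product over the
periodic momenta other than the `j`-th one of `sinh((γ_x - γ_θ)/2)`. -/
def nodeProd (n : ℕ) (γ : ℝ → ℝ) (j : Fin (n + 1)) (x : ℝ) : ℝ :=
  ∏ i : Fin n, Real.sinh ((γ x + γ (thetaInterior n i)) / 2) *
    Real.sinh ((γ x - γ (thetaP (n + 1) (j.succAbove i))) / 2)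

lemma nodeProd_mul_sin_eq_zero (hγ : ∀ x, Real.cosh (γ x) = a - c * Real.cos x)
    (hpos : ∀ x, 0 ≤ γ x) {n : ℕ} (i j : Fin (n + 1)) :
    nodeProd n γ j (thetaP (n + 1) i) *
      Real.sin ((thetaP (n + 1) i + thetaP (n + 1) j) / 2) = 0 := by
  have hzero : ∀ m : Fin (n + 1), m ≠ j → Real.cos (thetaP (n + 1) i) = Real.cos (thetaP (n + 1) m) →
      nodeProd n γ j (thetaP (n + 1) i) = 0 := by
    intro m hm h
    obtain ⟨l, rfl⟩ := Fin.exists_succAbove_eq hm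
    refine prod_eq_zero (mem_univ l) ?_
    rw [gamma_eq_of_cos_eq hγ hpos h]
    simp
  by_cases hij : i = j
  · subst hij
    have hN : ((n + 1 : ℕ) : ℝ) ≠ 0 := by positivity
    have hle : (i : ℕ) ≤ n + 1 := i.2.le
    by_cases h0 : (i : ℕ) = 0
    · simp [thetaP, h0]
    by_cases h1 : 2 * (i : ℕ) = n + 1
    · have : (thetaP (n + 1) i + thetaP (n + 1) i) / 2 = Real.pi := by
        have : (2 * (i : ℝ)) = (n + 1 : ℕ) := by exact_mod_cast h1
        rw [thetaP, this]; field_simp; ring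
      rw [this, Real.sin_pi, mul_zero]
    · have hlt : n + 1 - (i : ℕ) < n + 1 := by omega
      rw [hzero ⟨n + 1 - i, hlt⟩ ?_ ?_, zero_mul]
      · intro h
        have := congrArg Fin.val h
        simp only at this
        omega
      · have : thetaP (n + 1) ⟨n + 1 - i, hlt⟩ = 2 * Real.pi - thetaP (n + 1) i := by
          simp only [thetaP]
          rw [Nat.cast_sub hle]
          field_simp
        rw [this, Real.cos_two_pi_sub]
  · rw [hzero i hij rfl, zero_mul]

lemma prod_interior_eq_zero (hγ : ∀ x, Real.cosh (γ x) = a - c * Real.cos x)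
    (hpos : ∀ x, 0 ≤ γ x) {n : ℕ} (v : Fin n → ℝ) {k : ℕ} (hk : k < 2 * (n + 1)) (h0 : k ≠ 0)
    (h1 : k ≠ n + 1) :
    ∏ i, Real.sinh ((-γ (k * Real.pi / (n + 1 : ℕ)) + γ (thetaInterior n i)) / 2) *
      Real.sinh ((-γ (k * Real.pi / (n + 1 : ℕ)) - v i) / 2) = 0 := by
  have hN : ((n + 1 : ℕ) : ℝ) ≠ 0 := by positivity
  obtain ⟨i, hi⟩ : ∃ i : Fin n,
      Real.cos (k * Real.pi / (n + 1 : ℕ)) = Real.cos (thetaInterior n i) := by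
    rcases lt_or_gt_of_ne h1 with h | h
    · refine ⟨⟨k - 1, by omega⟩, ?_⟩
      rw [thetaInterior, Nat.cast_sub (by omega)]
      simp
    · refine ⟨⟨2 * (n + 1) - k - 1, by omega⟩, ?_⟩
      rw [← Real.cos_two_pi_sub, thetaInterior]
      congr 1
      simp only
      rw [Nat.cast_sub (by omega), Nat.cast_sub (by omega)]
      push_cast at hN ⊢
      field_simp
      ring
  refine prod_eq_zero (mem_univ i) ?_
  rw [gamma_eq_of_cos_eq hγ hpos hi]
  simp

variable {p q : ℝ → ℝ} {e f g : ℝ}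

lemma sum_nodeProd (hγ : ∀ x, Real.cosh (γ x) = a - c * Real.cos x) (hpos : ∀ x, 0 < γ x)
    (hcos : ∀ x, (p x ^ 2 - q x ^ 2) * Real.sinh (γ x) = e + f * Real.cos x)
    (hsin : ∀ x, 2 * p x * q x * Real.sinh (γ x) = g * Real.sin x)
    (hpq : ∀ x, p x ^ 2 + q x ^ 2 = 1) (hp : ∀ x, p x ≠ 0)
    {n : ℕ} (j : Fin (n + 1)) {t : ℝ} (ht : Real.sin ((n + 1 : ℕ) * t) ≠ 0) :
    ∑ i : Fin (n + 1), p (thetaA (n + 1) i) *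
        (p (thetaA (n + 1) i) * p t + q (thetaA (n + 1) i) * q t) *
        nodeProd n γ j (thetaA (n + 1) i) *
        Real.sin ((thetaA (n + 1) i + thetaP (n + 1) j) / 2) /
        Real.sin ((thetaA (n + 1) i - t) / 2) =
      2 * (n + 1 : ℕ) * p t * nodeProd n γ j t * Real.sin ((t + thetaP (n + 1) j) / 2) /
        Real.sin ((n + 1 : ℕ) * t) := by
  have hn : 0 < n + 1 := n.succ_pos
  have hs : ∀ x, Real.sinh (γ x) ≠ 0 := fun x => (Real.sinh_pos_iff.2 (hpos x)).ne'
  obtain ⟨A, B, hA, hB, hplus, hminus⟩ := exists_even_odd_parts hγ (fun i => γ (thetaInterior n i))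
    (fun i => γ (thetaP (n + 1) (j.succAbove i)))
  set X : ℝ → ℝ := fun x => p t * (e + f * Real.cos x) + q t * (g * Real.sin x) with hX
  set Q : ℝ → ℝ := fun x => (p t * A x + X x * B x) * Real.sin ((x + thetaP (n + 1) j) / 2) with hQ
  have hQtrig : IsTrigPoly (2 * (n + 1) - 1) Q := by
    have hXtrig : IsTrigPoly 2 X := by
      have := (((IsTrigPoly.const_two e).add (IsTrigPoly.cos.const_mul f)).const_mul (p t)).add
        ((IsTrigPoly.sin.const_mul g).const_mul (q t))
      exact this
    exact ((hA.const_mul (p t)).add (hB 0 X (by simpa using hXtrig))).mul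
      (IsTrigPoly.sin_add_half _)
  have hXA : ∀ x, X x = 2 * p x * (p x * p t + q x * q t) * Real.sinh (γ x) -
      p t * Real.sinh (γ x) := fun x => by
    simp only [hX]
    rw [← hcos, ← hsin]
    linear_combination (-(p t * Real.sinh (γ x))) * hpq x
  have hXB : ∀ x, X x = -(2 * q x * (p t * q x - q t * p x)) * Real.sinh (γ x) +
      p t * Real.sinh (γ x) := fun x => by
    rw [hXA]
    linear_combination (2 * p t * Real.sinh (γ x)) * hpq x
  have hsplit : ∀ x, Q x = (p x * (p x * p t + q x * q t) * nodeProd n γ j x +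
      q x * (p t * q x - q t * p x) * (A x - Real.sinh (γ x) * B x)) *
        Real.sin ((x + thetaP (n + 1) j) / 2) := fun x => by
    simp only [hQ]
    rw [nodeProd, hplus]
    linear_combination (B x / 2 * hXA x + B x / 2 * hXB x +
      -(p t * A x) * hpq x) * Real.sin ((x + thetaP (n + 1) j) / 2)
  have hnode : ∀ k < 2 * (n + 1), Q (k * Real.pi / (n + 1 : ℕ)) =
      p (k * Real.pi / (n + 1 : ℕ)) * (p (k * Real.pi / (n + 1 : ℕ)) * p t +
        q (k * Real.pi / (n + 1 : ℕ)) * q t) * nodeProd n γ j (k * Real.pi / (n + 1 : ℕ)) *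
        Real.sin ((k * Real.pi / (n + 1 : ℕ) + thetaP (n + 1) j) / 2) := by
    intro k hk
    have hzero : q (k * Real.pi / (n + 1 : ℕ)) *
        (A (k * Real.pi / (n + 1 : ℕ)) -
          Real.sinh (γ (k * Real.pi / (n + 1 : ℕ))) * B (k * Real.pi / (n + 1 : ℕ))) = 0 := by
      by_cases h : k ≠ 0 ∧ k ≠ n + 1
      · rw [← hminus, prod_interior_eq_zero hγ (fun x => (hpos x).le) _ hk h.1 h.2, mul_zero]
      · have h0 : Real.sin (k * Real.pi / (n + 1 : ℕ)) = 0 := by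
          rcases not_and_or.1 h with h | h <;> rw [not_ne_iff] at h <;> subst h
          · simp
          · have : ((n + 1 : ℕ) : ℝ) ≠ 0 := by positivity
            rw [mul_div_cancel_left₀ _ this, Real.sin_pi]
        have := hsin (k * Real.pi / (n + 1 : ℕ))
        rw [h0, mul_zero] at this
        have hq : q (k * Real.pi / (n + 1 : ℕ)) = 0 := by
          simpa [hs, hp] using this
        rw [hq, zero_mul]
    rw [hsplit]
    linear_combination ((p t * q (k * Real.pi / (n + 1 : ℕ)) -
      q t * p (k * Real.pi / (n + 1 : ℕ))) *
      Real.sin ((k * Real.pi / (n + 1 : ℕ) + thetaP (n + 1) j) / 2)) * hzero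
  have hQt : Q t = p t * nodeProd n γ j t * Real.sin ((t + thetaP (n + 1) j) / 2) := by
    rw [hsplit]
    linear_combination (p t * nodeProd n γ j t * Real.sin ((t + thetaP (n + 1) j) / 2)) * hpq t
  have key := hQtrig.sum_interpolation hn ht
  have hPeq : ∀ i : Fin (n + 1),
      ((2 * (i : ℕ) : ℕ) : ℝ) * Real.pi / (n + 1 : ℕ) = thetaP (n + 1) i := fun i => by
    rw [thetaP]; push_cast; ring
  have hAeq : ∀ i : Fin (n + 1),
      ((2 * (i : ℕ) + 1 : ℕ) : ℝ) * Real.pi / (n + 1 : ℕ) = thetaA (n + 1) i := fun i => by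
    rw [thetaA]; push_cast; ring
  rw [sum_range_two_mul (fun k : ℕ => (-1 : ℝ) ^ k * Q (k * Real.pi / (n + 1 : ℕ)) /
    Real.sin ((t - k * Real.pi / (n + 1 : ℕ)) / 2)), sum_eq_zero, zero_add, hQt] at key
  · rw [show 2 * ((n + 1 : ℕ) : ℝ) * p t * nodeProd n γ j t *
      Real.sin ((t + thetaP (n + 1) j) / 2) = 2 * (n + 1 : ℕ) * (p t * nodeProd n γ j t *
      Real.sin ((t + thetaP (n + 1) j) / 2)) by ring, ← key]
    refine sum_congr rfl fun i _ => ?_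
    rw [hnode _ (by omega), hAeq, pow_succ, pow_mul, neg_one_sq, one_pow, ← neg_sub, neg_div,
      Real.sin_neg, div_neg]
    ring
  · intro i _
    rw [hnode _ (by omega), hPeq, mul_assoc (p _ * _),
      nodeProd_mul_sin_eq_zero hγ (fun x => (hpos x).le)]
    simp

lemma prod_range_two_mul_succ_of_symm {f : ℕ → ℝ} {n : ℕ}
    (hf : ∀ k < n, f (2 * n + 1 - k) = f (k + 1)) :
    ∏ k ∈ range (2 * (n + 1)), f k = f 0 * f (n + 1) * (∏ i : Fin n, f (i + 1)) ^ 2 := by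
  rw [Fin.prod_univ_eq_prod_range (fun k => f (k + 1)), two_mul, prod_range_add, prod_range_succ',
    prod_range_succ' (fun k => f (n + 1 + k)), ← prod_range_reflect (fun k => f (n + 1 + (k + 1)))]
  have : ∏ k ∈ range n, f (n + 1 + (n - 1 - k + 1)) = ∏ k ∈ range n, f (k + 1) := by
    refine prod_congr rfl fun k hk => ?_
    rw [mem_range] at hk
    rw [← hf k hk]
    congr 1
    omega
  rw [this, add_zero]
  ring

/-- The factor `e^{ν_θ/2} / √(sinh γ_θ)`. -/
def amplitude (N : ℕ) (γ : ℝ → ℝ) (x : ℝ) : ℝ :=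
  Real.exp (nufun N γ x / 2) / Real.sqrt (Real.sinh (γ x))

lemma sinh_half_add_pos (hpos : ∀ x, 0 < γ x) (x y : ℝ) : 0 < Real.sinh ((γ x + γ y) / 2) :=
  Real.sinh_pos_iff.2 (half_pos (add_pos (hpos x) (hpos y)))

lemma amplitude_pos (hpos : ∀ x, 0 < γ x) (N : ℕ) (x : ℝ) : 0 < amplitude N γ x :=
  div_pos (Real.exp_pos _) (Real.sqrt_pos.2 (Real.sinh_pos_iff.2 (hpos x)))

lemma amplitude_mul_prod (hγ : ∀ x, Real.cosh (γ x) = a - c * Real.cos x) (hpos : ∀ x, 0 < γ x)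
    {σ : ℝ} (hσ : 0 < σ) (hp : ∀ x, 0 < p x)
    (hends : ∀ x, Real.sinh ((γ x + γ 0) / 2) * Real.sinh ((γ x + γ Real.pi) / 2) =
      σ ^ 2 * Real.sinh (γ x) * p x ^ 2) (n : ℕ) (x : ℝ) :
    amplitude (n + 1) γ x * ∏ i : Fin (n + 1), Real.sinh ((γ x + γ (thetaP (n + 1) i)) / 2) =
      σ * p x * ∏ i : Fin n, Real.sinh ((γ x + γ (thetaInterior n i)) / 2) := by
  have hN : ((n + 1 : ℕ) : ℝ) ≠ 0 := by positivity
  have hS := sinh_half_add_pos hpos x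
  have hs := Real.sinh_pos_iff.2 (hpos x)
  set PP := ∏ i : Fin (n + 1), Real.sinh ((γ x + γ (thetaP (n + 1) i)) / 2) with hPP
  set PA := ∏ i : Fin (n + 1), Real.sinh ((γ x + γ (thetaA (n + 1) i)) / 2) with hPA
  set PU := ∏ i : Fin n, Real.sinh ((γ x + γ (thetaInterior n i)) / 2) with hPU
  have hPPpos : 0 < PP := prod_pos fun i _ => hS _
  have hPApos : 0 < PA := prod_pos fun i _ => hS _
  have hPUpos : 0 < PU := prod_pos fun i _ => hS _
  have hall : PP * PA = σ ^ 2 * Real.sinh (γ x) * p x ^ 2 * PU ^ 2 := by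
    have h := prod_range_two_mul_succ_of_symm (n := n)
      (f := fun k => Real.sinh ((γ x + γ (k * Real.pi / (n + 1 : ℕ))) / 2)) ?_
    · rw [prod_range_two_mul] at h
      have e0 : ((0 : ℕ) : ℝ) * Real.pi / (n + 1 : ℕ) = 0 := by simp
      have e1 : ((n + 1 : ℕ) : ℝ) * Real.pi / (n + 1 : ℕ) = Real.pi :=
        mul_div_cancel_left₀ _ hN
      rw [← hends, hPP, hPA, hPU]
      simp only [e0, e1] at h
      have hP : ∀ i : Fin (n + 1), ((2 * (i : ℕ) : ℕ) : ℝ) * Real.pi / (n + 1 : ℕ) =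
          thetaP (n + 1) i := fun i => by rw [thetaP]; push_cast; rfl
      have hA : ∀ i : Fin (n + 1), ((2 * (i : ℕ) + 1 : ℕ) : ℝ) * Real.pi / (n + 1 : ℕ) =
          thetaA (n + 1) i := fun i => by rw [thetaA]; push_cast; rfl
      have hU : ∀ i : Fin n, (((i : ℕ) + 1 : ℕ) : ℝ) * Real.pi / (n + 1 : ℕ) =
          thetaInterior n i := fun i => by rw [thetaInterior]; push_cast; rfl
      simpa only [hP, hA, hU] using h
    · intro k hk
      have : γ (((2 * n + 1 - k : ℕ) : ℝ) * Real.pi / (n + 1 : ℕ)) =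
          γ (((k + 1 : ℕ) : ℝ) * Real.pi / (n + 1 : ℕ)) := by
        refine gamma_eq_of_cos_eq hγ (fun x => (hpos x).le) ?_
        rw [← Real.cos_two_pi_sub, Nat.cast_sub (by omega)]
        congr 1
        push_cast at hN ⊢
        field_simp
        ring
      simp only [this]
  have hamp : amplitude (n + 1) γ x ^ 2 * (PP * Real.sinh (γ x)) = PA := by
    rw [amplitude, div_pow, Real.sq_sqrt hs.le, ← Real.exp_nat_mul]
    have : ((2 : ℕ) : ℝ) * (nufun (n + 1) γ x / 2) = nufun (n + 1) γ x := by push_cast; ring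
    rw [this, nufun, Real.exp_log (div_pos hPApos hPPpos)]
    field_simp
  refine (sq_eq_sq₀ (mul_pos (amplitude_pos hpos _ x) hPPpos).le
    (mul_pos (mul_pos hσ (hp x)) hPUpos).le).1 ?_
  refine mul_right_cancel₀ hs.ne' ?_
  linear_combination PP * hamp + hall

lemma nodeProd_mul_eq (hγ : ∀ x, Real.cosh (γ x) = a - c * Real.cos x) (hpos : ∀ x, 0 < γ x)
    {σ : ℝ} (hσ : 0 < σ) (hp : ∀ x, 0 < p x) (hc : c ≠ 0)
    (hends : ∀ x, Real.sinh ((γ x + γ 0) / 2) * Real.sinh ((γ x + γ Real.pi) / 2) =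
      σ ^ 2 * Real.sinh (γ x) * p x ^ 2) (n : ℕ) :
    ∃ κ : ℝ, κ ≠ 0 ∧ ∀ j x, p x * nodeProd n γ j x *
      (Real.sin ((x + thetaP (n + 1) j) / 2) * Real.sin ((x - thetaP (n + 1) j) / 2)) =
      κ * Real.sin ((n + 1 : ℕ) * x / 2) ^ 2 *
        (amplitude (n + 1) γ x * Real.sinh ((γ x + γ (thetaP (n + 1) j)) / 2)) := by
  obtain ⟨κ, hκ, hprod⟩ := exists_prod_cos_sub_cos n.succ_pos
  refine ⟨(c / 2) ^ (n + 1) * κ / (σ * c), by positivity, fun j x => ?_⟩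
  have hS := sinh_half_add_pos hpos x
  have hfac : ∀ y, Real.sinh ((γ x + γ y) / 2) * Real.sinh ((γ x - γ y) / 2) =
      c / 2 * (Real.cos y - Real.cos x) := fun y => by
    rw [sinh_half_add_mul_sinh_half_sub, sub_self, zero_div, Real.cosh_zero, Real.sinh_zero,
      ← two_mul, mul_div_cancel_left₀ _ two_ne_zero, hγ, hγ]
    ring
  have hsin : Real.cos (thetaP (n + 1) j) - Real.cos x =
      2 * (Real.sin ((x + thetaP (n + 1) j) / 2) * Real.sin ((x - thetaP (n + 1) j) / 2)) := by
    rw [Real.cos_sub_cos, add_comm (thetaP _ _), ← neg_sub x, neg_div, Real.sin_neg]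
    ring
  set PP := ∏ i : Fin (n + 1), Real.sinh ((γ x + γ (thetaP (n + 1) i)) / 2) with hPP
  have hPPpos : 0 < PP := prod_pos fun i _ => hS _
  have hminus : nodeProd n γ j x * Real.sinh ((γ x - γ (thetaP (n + 1) j)) / 2) * PP =
      (∏ i : Fin n, Real.sinh ((γ x + γ (thetaInterior n i)) / 2)) *
        ((c / 2) ^ (n + 1) * (κ * Real.sin ((n + 1 : ℕ) * x / 2) ^ 2)) := by
    have h : ∏ i : Fin (n + 1), Real.sinh ((γ x + γ (thetaP (n + 1) i)) / 2) *
        Real.sinh ((γ x - γ (thetaP (n + 1) i)) / 2) =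
        (c / 2) ^ (n + 1) * (κ * Real.sin ((n + 1 : ℕ) * x / 2) ^ 2) := by
      rw [prod_congr rfl fun i _ => hfac (thetaP (n + 1) i), prod_mul_distrib, hprod, prod_const,
        card_univ, Fintype.card_fin]
    rw [← h, prod_mul_distrib, ← hPP,
      Fin.prod_univ_succAbove (fun i => Real.sinh ((γ x - γ (thetaP (n + 1) i)) / 2)) j,
      nodeProd, prod_mul_distrib]
    ring
  have hamp := amplitude_mul_prod hγ hpos hσ hp hends n x
  rw [← hPP] at hamp
  have hh := hfac (thetaP (n + 1) j)
  rw [hsin] at hh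
  have hcancel : nodeProd n γ j x * Real.sinh ((γ x - γ (thetaP (n + 1) j)) / 2) * p x * σ =
      amplitude (n + 1) γ x * ((c / 2) ^ (n + 1) * (κ * Real.sin ((n + 1 : ℕ) * x / 2) ^ 2)) := by
    refine mul_right_cancel₀ hPPpos.ne' ?_
    linear_combination p x * σ * hminus -
      (c / 2) ^ (n + 1) * (κ * Real.sin ((n + 1 : ℕ) * x / 2) ^ 2) * hamp
  rw [div_mul_eq_mul_div, div_mul_eq_mul_div, eq_div_iff (mul_ne_zero hσ.ne' hc)]
  linear_combination Real.sinh ((γ x + γ (thetaP (n + 1) j)) / 2) * hcancel -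
    p x * nodeProd n γ j x * σ * hh

lemma sin_half_thetaA_sub_thetaP_ne_zero {N : ℕ} (hN : 0 < N) (i j : Fin N) :
    Real.sin ((thetaA N i - thetaP N j) / 2) ≠ 0 := by
  intro h
  obtain ⟨m, hm⟩ := Real.sin_eq_zero_iff.1 h
  have hN' : (N : ℝ) ≠ 0 := by exact_mod_cast hN.ne'
  have hpi := Real.pi_ne_zero
  rw [thetaA, thetaP] at hm
  field_simp at hm
  have : (N : ℤ) * m * 2 = 2 * (i : ℤ) + 1 - 2 * (j : ℤ) := by
    exact_mod_cast (by linear_combination hm :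
      (N : ℝ) * m * 2 = 2 * (i : ℝ) + 1 - 2 * (j : ℝ))
  omega

lemma sin_sq_thetaA {N : ℕ} (hN : 0 < N) (i : Fin N) : Real.sin (N * thetaA N i / 2) ^ 2 = 1 := by
  have hN' : (N : ℝ) ≠ 0 := by exact_mod_cast hN.ne'
  have : N * thetaA N i / 2 = Real.pi / 2 + (i : ℕ) * Real.pi := by
    rw [thetaA]; field_simp; ring
  rw [this, Real.sin_add_nat_mul_pi, Real.sin_pi_div_two, mul_one, ← pow_mul, mul_comm, pow_mul]
  simp

lemma sin_half_eq_chebyshev (n : ℕ) (j : Fin (n + 1)) (t : ℝ) :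
    Real.sin ((n + 1 : ℕ) * t / 2) = (-1) ^ (j : ℕ) *
      (Polynomial.Chebyshev.U ℝ n).eval (Real.cos ((t - thetaP (n + 1) j) / 2)) *
        Real.sin ((t - thetaP (n + 1) j) / 2) := by
  have hN : ((n + 1 : ℕ) : ℝ) ≠ 0 := by positivity
  have : (n + 1 : ℕ) * t / 2 = ((n : ℤ) + 1) * ((t - thetaP (n + 1) j) / 2) + (j : ℕ) * Real.pi := by
    rw [thetaP]; push_cast at hN ⊢; field_simp; ring
  rw [this, Real.sin_add_nat_mul_pi, mul_assoc, Polynomial.Chebyshev.U_real_cos]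

/-- The sum over antiperiodic momenta that interpolates `amplitude t * sinh ((γ_t + γ_θ) / 2)`. -/
def cauchySum (n : ℕ) (γ p q : ℝ → ℝ) (j : Fin (n + 1)) (t : ℝ) : ℝ :=
  ∑ i : Fin (n + 1), (p (thetaA (n + 1) i) * p t + q (thetaA (n + 1) i) * q t) *
    (amplitude (n + 1) γ (thetaA (n + 1) i) *
      Real.sinh ((γ (thetaA (n + 1) i) + γ (thetaP (n + 1) j)) / 2)) /
    (Real.sin ((thetaA (n + 1) i - thetaP (n + 1) j) / 2) *
      Real.sin ((thetaA (n + 1) i - t) / 2))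

lemma cauchySum_mul_cos (hγ : ∀ x, Real.cosh (γ x) = a - c * Real.cos x) (hpos : ∀ x, 0 < γ x)
    (hcos : ∀ x, (p x ^ 2 - q x ^ 2) * Real.sinh (γ x) = e + f * Real.cos x)
    (hsin : ∀ x, 2 * p x * q x * Real.sinh (γ x) = g * Real.sin x)
    (hpq : ∀ x, p x ^ 2 + q x ^ 2 = 1) {σ : ℝ} (hσ : 0 < σ) (hp : ∀ x, 0 < p x) (hc : c ≠ 0)
    (hends : ∀ x, Real.sinh ((γ x + γ 0) / 2) * Real.sinh ((γ x + γ Real.pi) / 2) =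
      σ ^ 2 * Real.sinh (γ x) * p x ^ 2) {n : ℕ} (j : Fin (n + 1)) {t : ℝ}
    (ht : Real.sin ((n + 1 : ℕ) * t) ≠ 0) :
    cauchySum n γ p q j t * Real.cos ((n + 1 : ℕ) * t / 2) =
      (n + 1 : ℕ) * (-1) ^ (j : ℕ) * (amplitude (n + 1) γ t *
        Real.sinh ((γ t + γ (thetaP (n + 1) j)) / 2)) *
        (Polynomial.Chebyshev.U ℝ n).eval (Real.cos ((t - thetaP (n + 1) j) / 2)) := by
  obtain ⟨κ, hκ, hnode⟩ := nodeProd_mul_eq hγ hpos hσ hp hc hends n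
  have key := sum_nodeProd hγ hpos hcos hsin hpq (fun x => (hp x).ne') j ht
  have hdouble : Real.sin ((n + 1 : ℕ) * t) =
      2 * Real.sin ((n + 1 : ℕ) * t / 2) * Real.cos ((n + 1 : ℕ) * t / 2) := by
    rw [← Real.sin_two_mul, mul_div_cancel₀ _ two_ne_zero]
  have hcosne : Real.cos ((n + 1 : ℕ) * t / 2) ≠ 0 := fun h => ht (by rw [hdouble, h, mul_zero])
  have hsinne : Real.sin ((n + 1 : ℕ) * t / 2) ≠ 0 := fun h => ht (by rw [hdouble, h]; simp)
  have hcheb := sin_half_eq_chebyshev n j t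
  have hsne : Real.sin ((t - thetaP (n + 1) j) / 2) ≠ 0 := fun h => hsinne (by
    rw [hcheb, h, mul_zero])
  have hsum : ∑ i : Fin (n + 1), p (thetaA (n + 1) i) *
        (p (thetaA (n + 1) i) * p t + q (thetaA (n + 1) i) * q t) *
        nodeProd n γ j (thetaA (n + 1) i) *
        Real.sin ((thetaA (n + 1) i + thetaP (n + 1) j) / 2) /
        Real.sin ((thetaA (n + 1) i - t) / 2) = κ * cauchySum n γ p q j t := by
    rw [cauchySum, mul_sum]
    refine sum_congr rfl fun i _ => ?_
    have h0 := sin_half_thetaA_sub_thetaP_ne_zero n.succ_pos i j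
    have h1 := hnode j (thetaA (n + 1) i)
    rw [sin_sq_thetaA n.succ_pos, mul_one] at h1
    rw [← div_div, mul_div_assoc']
    congr 1
    rw [mul_div_assoc', eq_div_iff h0]
    linear_combination (p (thetaA (n + 1) i) * p t + q (thetaA (n + 1) i) * q t) * h1
  have ht' := hnode j t
  rw [hsum, eq_div_iff ht, hdouble] at key
  refine mul_right_cancel₀ (mul_ne_zero (mul_ne_zero hκ hsne) hsinne) ?_
  linear_combination (Real.sin ((t - thetaP (n + 1) j) / 2) / 2) * key + (n + 1 : ℕ) * ht' +
    (n + 1 : ℕ) * κ * Real.sin ((n + 1 : ℕ) * t / 2) * (amplitude (n + 1) γ t *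
        Real.sinh ((γ t + γ (thetaP (n + 1) j)) / 2)) * hcheb

lemma continuous_gamma (hγ : ∀ x, Real.cosh (γ x) = a - c * Real.cos x) (hpos : ∀ x, 0 ≤ γ x) :
    Continuous γ := by
  have : γ = fun x => Real.arcosh (a - c * Real.cos x) := by
    funext x
    rw [← hγ, Real.arcosh_cosh (hpos x)]
  rw [this]
  refine Real.continuousOn_arcosh.comp_continuous (by fun_prop) fun x => ?_
  rw [← hγ]
  exact Real.one_le_cosh _

lemma continuous_amplitude (hcont : Continuous γ) (hpos : ∀ x, 0 < γ x) (N : ℕ) :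
    Continuous (amplitude N γ) := by
  have hprod : ∀ θ : Fin N → ℝ, Continuous fun x => ∏ j, Real.sinh ((γ x + γ (θ j)) / 2) :=
    fun θ => continuous_finsetProd _ fun j _ => by fun_prop
  have hne : ∀ (θ : Fin N → ℝ) (x : ℝ), ∏ j, Real.sinh ((γ x + γ (θ j)) / 2) ≠ 0 :=
    fun θ x => prod_ne_zero_iff.2 fun j _ => (sinh_half_add_pos hpos _ _).ne'
  refine Continuous.div ?_ (by fun_prop)
    fun x => (Real.sqrt_pos.2 (Real.sinh_pos_iff.2 (hpos x))).ne'
  refine Real.continuous_exp.comp (Continuous.div_const ?_ 2)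
  exact ((hprod _).div (hprod _) (hne _)).log fun x => div_ne_zero (hne _ x) (hne _ x)

lemma cauchySum_thetaP_mul (hγ : ∀ x, Real.cosh (γ x) = a - c * Real.cos x) (hpos : ∀ x, 0 < γ x)
    (hcos : ∀ x, (p x ^ 2 - q x ^ 2) * Real.sinh (γ x) = e + f * Real.cos x)
    (hsin : ∀ x, 2 * p x * q x * Real.sinh (γ x) = g * Real.sin x)
    (hpq : ∀ x, p x ^ 2 + q x ^ 2 = 1) {σ : ℝ} (hσ : 0 < σ) (hp : ∀ x, 0 < p x) (hc : c ≠ 0)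
    (hends : ∀ x, Real.sinh ((γ x + γ 0) / 2) * Real.sinh ((γ x + γ Real.pi) / 2) =
      σ ^ 2 * Real.sinh (γ x) * p x ^ 2) (hpc : Continuous p) (hqc : Continuous q) {n : ℕ}
    (j k : Fin (n + 1)) :
    cauchySum n γ p q j (thetaP (n + 1) k) * (-1) ^ (k : ℕ) =
      (n + 1 : ℕ) * (-1) ^ (j : ℕ) * (amplitude (n + 1) γ (thetaP (n + 1) k) *
        Real.sinh ((γ (thetaP (n + 1) k) + γ (thetaP (n + 1) j)) / 2)) *
        (Polynomial.Chebyshev.U ℝ n).eval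
          (Real.cos ((thetaP (n + 1) k - thetaP (n + 1) j) / 2)) := by
  have hN : ((n + 1 : ℕ) : ℝ) ≠ 0 := by positivity
  have hγc := continuous_gamma hγ fun x => (hpos x).le
  have hac := continuous_amplitude hγc hpos (n + 1)
  set θ := thetaP (n + 1) k with hθ
  have hcosθ : Real.cos ((n + 1 : ℕ) * θ / 2) = (-1) ^ (k : ℕ) := by
    have : (n + 1 : ℕ) * θ / 2 = (k : ℕ) * Real.pi := by
      rw [hθ, thetaP]; field_simp
    rw [this, Real.cos_nat_mul_pi]
  have hsum : ContinuousAt (cauchySum n γ p q j) θ := by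
    refine tendsto_finsetSum _ fun i _ => ?_
    refine ContinuousAt.div (by fun_prop) (by fun_prop) (mul_ne_zero ?_ ?_) <;>
      exact sin_half_thetaA_sub_thetaP_ne_zero n.succ_pos _ _
  have hne : ∀ᶠ t in nhdsWithin θ {θ}ᶜ, Real.sin ((n + 1 : ℕ) * t) ≠ 0 := by
    have hd : HasDerivAt (fun t => Real.sin ((n + 1 : ℕ) * t))
        (Real.cos ((n + 1 : ℕ) * θ) * ((n + 1 : ℕ) * 1)) θ :=
      ((hasDerivAt_id θ).const_mul _).sin
    refine hd.eventually_ne ?_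
    have : (n + 1 : ℕ) * θ = ((2 * k : ℕ) : ℝ) * Real.pi := by
      rw [hθ, thetaP]; push_cast at hN ⊢; field_simp
    rw [this, Real.cos_nat_mul_pi, mul_one]
    exact mul_ne_zero (pow_ne_zero _ (by norm_num)) hN
  rw [← hcosθ]
  refine tendsto_nhds_unique_of_eventuallyEq (l := nhdsWithin θ {θ}ᶜ)
    (f := fun t => cauchySum n γ p q j t * Real.cos ((n + 1 : ℕ) * t / 2)) ?_ ?_
    (hne.mono fun t ht => cauchySum_mul_cos hγ hpos hcos hsin hpq hσ hp hc hends j ht)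
  · refine (ContinuousAt.mul hsum ?_).tendsto.mono_left nhdsWithin_le_nhds
    fun_prop
  · refine Filter.Tendsto.mono_left (ContinuousAt.tendsto (f := fun t => (n + 1 : ℕ) *
      (-1) ^ (j : ℕ) * (amplitude (n + 1) γ t *
        Real.sinh ((γ t + γ (thetaP (n + 1) j)) / 2)) *
        (Polynomial.Chebyshev.U ℝ n).eval (Real.cos ((t - thetaP (n + 1) j) / 2))) ?_)
      nhdsWithin_le_nhds
    fun_prop

lemma chebyshev_thetaP_sub {n : ℕ} {j k : Fin (n + 1)} (hjk : k ≠ j) :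
    (Polynomial.Chebyshev.U ℝ n).eval
      (Real.cos ((thetaP (n + 1) k - thetaP (n + 1) j) / 2)) = 0 := by
  have hN : ((n + 1 : ℕ) : ℝ) ≠ 0 := by positivity
  have hpi := Real.pi_ne_zero
  set s := (thetaP (n + 1) k - thetaP (n + 1) j) / 2 with hs
  have hNs : s * (n + 1 : ℕ) = ((k : ℤ) - (j : ℤ) : ℤ) * Real.pi := by
    rw [hs, thetaP, thetaP]; push_cast at hN ⊢; field_simp
  have hsin : Real.sin s ≠ 0 := by
    intro h
    obtain ⟨m, hm⟩ := Real.sin_eq_zero_iff.1 h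
    rw [← hm] at hNs
    have h1 : (m : ℤ) * (n + 1 : ℕ) = (k : ℤ) - (j : ℤ) := by
      have : ((m * (n + 1 : ℕ) : ℤ) : ℝ) = (((k : ℤ) - (j : ℤ) : ℤ) : ℝ) := by
        refine mul_right_cancel₀ hpi ?_
        rw [← hNs]; push_cast; ring
      exact_mod_cast this
    have h2 := k.2
    have h3 := j.2
    have hdvd : ((n + 1 : ℕ) : ℤ) ∣ (k : ℤ) - (j : ℤ) := ⟨m, by rw [← h1, mul_comm]⟩
    have h0 := Int.eq_zero_of_abs_lt_dvd hdvd (by rw [abs_lt]; omega)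
    exact hjk (Fin.ext (by omega))
  refine mul_right_cancel₀ hsin ?_
  rw [Polynomial.Chebyshev.U_real_cos, zero_mul]
  have : ((n : ℤ) + 1 : ℝ) * s = ((k : ℤ) - (j : ℤ) : ℤ) * Real.pi := by
    rw [← hNs]; push_cast; ring
  rw [this, Real.sin_int_mul_pi]

lemma cauchySum_thetaP (hγ : ∀ x, Real.cosh (γ x) = a - c * Real.cos x) (hpos : ∀ x, 0 < γ x)
    (hcos : ∀ x, (p x ^ 2 - q x ^ 2) * Real.sinh (γ x) = e + f * Real.cos x)
    (hsin : ∀ x, 2 * p x * q x * Real.sinh (γ x) = g * Real.sin x)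
    (hpq : ∀ x, p x ^ 2 + q x ^ 2 = 1) {σ : ℝ} (hσ : 0 < σ) (hp : ∀ x, 0 < p x) (hc : c ≠ 0)
    (hends : ∀ x, Real.sinh ((γ x + γ 0) / 2) * Real.sinh ((γ x + γ Real.pi) / 2) =
      σ ^ 2 * Real.sinh (γ x) * p x ^ 2) (hpc : Continuous p) (hqc : Continuous q) {n : ℕ}
    (j k : Fin (n + 1)) :
    cauchySum n γ p q j (thetaP (n + 1) k) =
      if k = j then (n + 1 : ℕ) ^ 2 * (amplitude (n + 1) γ (thetaP (n + 1) j) *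
        Real.sinh (γ (thetaP (n + 1) j))) else 0 := by
  have h := cauchySum_thetaP_mul hγ hpos hcos hsin hpq hσ hp hc hends hpc hqc j k
  have hone : ((-1 : ℝ)) ^ (k : ℕ) ≠ 0 := pow_ne_zero _ (by norm_num)
  refine mul_right_cancel₀ hone ?_
  rw [h]
  split_ifs with hkj
  · subst hkj
    rw [sub_self, zero_div, Real.cos_zero, Polynomial.Chebyshev.U_eval_one, add_self_div_two]
    push_cast
    ring
  · rw [chebyshev_thetaP_sub hkj, mul_zero, zero_mul]

/-- The claimed inverse of `Dmat`. -/
def DmatInv (N : ℕ) (l : ℤ) (γ : ℝ → ℝ) : Matrix (Fin N) (Fin N) ℂ :=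
  Matrix.of fun j k =>
    Complex.I *
        Complex.exp (-Complex.I * ((l : ℂ) - 2⁻¹) *
          ((thetaA N j : ℝ) - (thetaP N k : ℝ))) *
        ((Real.exp ((nufun N γ (thetaA N j) - nufun N γ (thetaP N k)) / 2) : ℝ) : ℂ) /
        ((N : ℂ) *
          ((Real.sqrt (Real.sinh (γ (thetaA N j)) * Real.sinh (γ (thetaP N k))) : ℝ) : ℂ)) *
        ((Real.sinh ((γ (thetaA N j) + γ (thetaP N k)) / 2) : ℝ) : ℂ) /
        Complex.sin ((((thetaA N j : ℝ) : ℂ) - (thetaP N k : ℝ)) / 2)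

lemma exp_half_sub_div_sqrt (hpos : ∀ x, 0 < γ x) (N : ℕ) (x y : ℝ) :
    Real.exp ((nufun N γ x - nufun N γ y) / 2) / Real.sqrt (Real.sinh (γ x) * Real.sinh (γ y)) =
      amplitude N γ x / (amplitude N γ y * Real.sinh (γ y)) := by
  have hx := Real.sinh_pos_iff.2 (hpos x)
  have hy := Real.sinh_pos_iff.2 (hpos y)
  have hx' := (Real.sqrt_pos.2 hx).ne'
  have hy' := (Real.sqrt_pos.2 hy).ne'
  rw [amplitude, amplitude, sub_div, Real.exp_sub, Real.sqrt_mul hx.le]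
  have := Real.mul_self_sqrt hy.le
  generalize Real.sqrt (Real.sinh (γ y)) = r at *
  rw [← this]
  field_simp

lemma div_add_div_of_unit {p p' q q' : ℝ} (h : p ^ 2 + q ^ 2 = 1) (h' : p' ^ 2 + q' ^ 2 = 1) :
    ((p' : ℂ) + q' * Complex.I) / (p + q * Complex.I) +
      (p + q * Complex.I) / (p' + q' * Complex.I) = 2 * ((p * p' + q * q' : ℝ) : ℂ) := by
  have hC : ((p : ℂ) + q * Complex.I) * (p - q * Complex.I) = 1 := by
    have : (p : ℂ) ^ 2 + (q : ℂ) ^ 2 = 1 := by exact_mod_cast h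
    linear_combination this - (q : ℂ) ^ 2 * Complex.I_sq
  have hC' : ((p' : ℂ) + q' * Complex.I) * (p' - q' * Complex.I) = 1 := by
    have : (p' : ℂ) ^ 2 + (q' : ℂ) ^ 2 = 1 := by exact_mod_cast h'
    linear_combination this - (q' : ℂ) ^ 2 * Complex.I_sq
  rw [div_eq_mul_inv, div_eq_mul_inv, inv_eq_of_mul_eq_one_right hC, inv_eq_of_mul_eq_one_right hC']
  push_cast
  linear_combination (-2 * (q : ℂ) * q') * Complex.I_sq

lemma Dmat_mul_DmatInv_apply {α β : ℝ} (hpos : ∀ x, 0 < γ x)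
    (hpq : ∀ x, p x ^ 2 + q x ^ 2 = 1)
    (hsqb : ∀ x, sqb α β x = p x + q x * Complex.I) {n : ℕ} (l : ℤ) (i k : Fin (n + 1)) :
    (Dmat (n + 1) l α β * DmatInv (n + 1) l γ) i k =
      Complex.exp (-Complex.I * ((l : ℂ) - 2⁻¹) *
          ((thetaP (n + 1) i : ℝ) - (thetaP (n + 1) k : ℝ))) *
        ((cauchySum n γ p q k (thetaP (n + 1) i) / ((n + 1 : ℕ) ^ 2 *
          (amplitude (n + 1) γ (thetaP (n + 1) k) * Real.sinh (γ (thetaP (n + 1) k)))) : ℝ) :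
            ℂ) := by
  have hN : ((n + 1 : ℕ) : ℂ) ≠ 0 := by exact_mod_cast n.succ_ne_zero
  rw [Matrix.mul_apply, cauchySum, sum_div, Complex.ofReal_sum, mul_sum]
  refine sum_congr rfl fun j _ => ?_
  have hexp := Complex.exp_add (-Complex.I * ((l : ℂ) - 2⁻¹) *
    ((thetaP (n + 1) i : ℝ) - (thetaA (n + 1) j : ℝ))) (-Complex.I * ((l : ℂ) - 2⁻¹) *
    ((thetaA (n + 1) j : ℝ) - (thetaP (n + 1) k : ℝ)))
  rw [← mul_add, sub_add_sub_cancel] at hexp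
  have h1 := sin_half_thetaA_sub_thetaP_ne_zero n.succ_pos j i
  have h2 := sin_half_thetaA_sub_thetaP_ne_zero n.succ_pos j k
  have hamp := congrArg (fun r : ℝ => (r : ℂ))
    (exp_half_sub_div_sqrt hpos (n + 1) (thetaA (n + 1) j) (thetaP (n + 1) k))
  simp only [Complex.ofReal_div] at hamp
  have hsin : ∀ x y : ℝ, Complex.sin (((x : ℂ) - y) / 2) = (Real.sin ((x - y) / 2) : ℂ) :=
    fun x y => by push_cast; rfl
  rw [Dmat, DmatInv, Matrix.of_apply, Matrix.of_apply, hsqb, hsqb,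
    div_add_div_of_unit (hpq _) (hpq _), hexp, hsin, hsin, mul_div_mul_comm, hamp]
  have hA := (amplitude_pos hpos (n + 1) (thetaP (n + 1) k)).ne'
  have hS := (Real.sinh_pos_iff.2 (hpos (thetaP (n + 1) k))).ne'
  rw [← Complex.ofReal_ne_zero] at h1 h2 hA hS
  simp only [Complex.ofReal_div, Complex.ofReal_mul, Complex.ofReal_pow, Complex.ofReal_natCast,
    Complex.ofReal_add]
  field_simp

lemma Dmat_mul_DmatInv {α β : ℝ} (hγ : ∀ x, Real.cosh (γ x) = a - c * Real.cos x)
    (hpos : ∀ x, 0 < γ x)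
    (hcos : ∀ x, (p x ^ 2 - q x ^ 2) * Real.sinh (γ x) = e + f * Real.cos x)
    (hsin : ∀ x, 2 * p x * q x * Real.sinh (γ x) = g * Real.sin x)
    (hpq : ∀ x, p x ^ 2 + q x ^ 2 = 1) {σ : ℝ} (hσ : 0 < σ) (hp : ∀ x, 0 < p x) (hc : c ≠ 0)
    (hends : ∀ x, Real.sinh ((γ x + γ 0) / 2) * Real.sinh ((γ x + γ Real.pi) / 2) =
      σ ^ 2 * Real.sinh (γ x) * p x ^ 2) (hpc : Continuous p) (hqc : Continuous q)
    (hsqb : ∀ x, sqb α β x = p x + q x * Complex.I) (n : ℕ) (l : ℤ) :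
    Dmat (n + 1) l α β * DmatInv (n + 1) l γ = 1 := by
  ext i k
  rw [Dmat_mul_DmatInv_apply hpos hpq hsqb,
    cauchySum_thetaP hγ hpos hcos hsin hpq hσ hp hc hends hpc hqc]
  by_cases h : i = k
  · subst h
    have hA := (amplitude_pos hpos (n + 1) (thetaP (n + 1) i)).ne'
    have hS := (Real.sinh_pos_iff.2 (hpos (thetaP (n + 1) i))).ne'
    rw [if_pos rfl, div_self (by positivity), sub_self, mul_zero, Complex.exp_zero,
      Matrix.one_apply_eq, Complex.ofReal_one, one_mul]
  · rw [if_neg h, zero_div, Complex.ofReal_zero, mul_zero, Matrix.one_apply_ne h]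

lemma half_angle_identities {s W V p q : ℝ} (hs : 0 < s) (hW : 0 < W) (h : W ^ 2 + V ^ 2 = s ^ 2)
    (hp : p = Real.sqrt ((1 + W / s) / 2)) (hq : q = V / (2 * p * s)) :
    0 < p ∧ p ^ 2 = (1 + W / s) / 2 ∧ p ^ 2 + q ^ 2 = 1 ∧ (p ^ 2 - q ^ 2) * s = W ∧
      2 * p * q * s = V := by
  have hpos : 0 < (1 + W / s) / 2 := by positivity
  have hp0 : 0 < p := hp ▸ Real.sqrt_pos.2 hpos
  have hp2 : p ^ 2 = (1 + W / s) / 2 := by rw [hp, Real.sq_sqrt hpos.le]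
  have hq2 : q ^ 2 = (1 - W / s) / 2 := by
    have : s + W ≠ 0 := by positivity
    rw [hq, div_pow, mul_pow, mul_pow, hp2]
    field_simp
    linear_combination h
  refine ⟨hp0, hp2, by rw [hp2, hq2]; ring, ?_, ?_⟩
  · rw [hp2, hq2]; field_simp; ring
  · rw [hq]; field_simp

lemma sqb_eq {α β x ρ s p q : ℝ} (hρ : ρ ≠ 0) (hs : 0 < s) (hp : 0 < p)
    (hpq : p ^ 2 + q ^ 2 = 1) (hW : 0 < (p ^ 2 - q ^ 2) * s)
    (hre : 1 + α * β - (α + β) * Real.cos x = ρ * ((p ^ 2 - q ^ 2) * s))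
    (him : -(α - β) * Real.sin x = ρ * (2 * p * q * s)) :
    sqb α β x = p + q * Complex.I := by
  have hexp : Complex.exp (Complex.I * x) = Complex.cos x + Complex.sin x * Complex.I := by
    rw [mul_comm, Complex.exp_mul_I]
  have hexp' : Complex.exp (-Complex.I * x) = Complex.cos x - Complex.sin x * Complex.I := by
    rw [show -Complex.I * (x : ℂ) = -(x : ℂ) * Complex.I by ring, Complex.exp_mul_I,
      Complex.cos_neg, Complex.sin_neg]
    ring
  have hreC := congrArg (fun r : ℝ => (r : ℂ)) hre
  have himC := congrArg (fun r : ℝ => (r : ℂ)) him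
  have hpqC := congrArg (fun r : ℝ => (r : ℂ)) hpq
  push_cast at hreC himC hpqC
  have hsq := Complex.sin_sq_add_cos_sq (x : ℂ)
  have hnum : ((1 : ℂ) - α * Complex.exp (Complex.I * x)) *
      (1 - β * Complex.exp (-Complex.I * x)) = ρ * s * (p + q * Complex.I) ^ 2 := by
    rw [hexp, hexp']
    linear_combination hreC + himC * Complex.I + α * β * hsq -
      (α * β * Complex.sin x ^ 2 + ρ * s * q ^ 2) * Complex.I_sq
  have hden : ((1 : ℂ) - β * Complex.exp (Complex.I * x)) *
      (1 - α * Complex.exp (-Complex.I * x)) = ρ * s * (p - q * Complex.I) ^ 2 := by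
    rw [hexp, hexp']
    linear_combination hreC - himC * Complex.I + α * β * hsq -
      (α * β * Complex.sin x ^ 2 + ρ * s * q ^ 2) * Complex.I_sq
  have hunit : ((p : ℂ) + q * Complex.I) * (p - q * Complex.I) = 1 := by
    linear_combination hpqC - (q : ℂ) ^ 2 * Complex.I_sq
  have hquot : ((1 : ℂ) - α * Complex.exp (Complex.I * x)) *
      (1 - β * Complex.exp (-Complex.I * x)) / (((1 : ℂ) - β * Complex.exp (Complex.I * x)) *
      (1 - α * Complex.exp (-Complex.I * x))) = (((p : ℂ) + q * Complex.I) ^ 2) ^ 2 := by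
    have h1 := left_ne_zero_of_mul_eq_one hunit
    have h2 := right_ne_zero_of_mul_eq_one hunit
    have hρ' : (ρ : ℂ) ≠ 0 := by exact_mod_cast hρ
    have hs' : (s : ℂ) ≠ 0 := by exact_mod_cast hs.ne'
    rw [hnum, hden, div_eq_iff (by positivity)]
    linear_combination (-(ρ * s * ((p : ℂ) + q * Complex.I) ^ 2)) *
      (((p : ℂ) + q * Complex.I) * (p - q * Complex.I) + 1) * hunit
  rw [sqb, bfun, hquot, Complex.sq_cpow_two_inv, Complex.sq_cpow_two_inv]
  · simpa using hp
  · have : (((p : ℂ) + q * Complex.I) ^ 2).re = p ^ 2 - q ^ 2 := by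
      simp [pow_two]
    rw [this]
    exact pos_of_mul_pos_left hW hs.le

lemma coupling_identities {K L α β : ℝ} (hL : 0 < L)
    (hα : α = Real.tanh K * (Real.cosh L / Real.sinh L)) (hβ : β = Real.tanh K * Real.tanh L) :
    ∃ ρ : ℝ, ρ ≠ 0 ∧ 1 + α * β = ρ * (Real.cosh (2 * K) * Real.sinh (2 * L)) ∧
      α + β = ρ * (Real.sinh (2 * K) * Real.cosh (2 * L)) ∧ α - β = ρ * Real.sinh (2 * K) := by
  have hcK := (Real.cosh_pos K).ne'
  have hcL := (Real.cosh_pos L).ne'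
  have hsL := (Real.sinh_pos_iff.2 hL).ne'
  have hL2 := Real.cosh_sq L
  rw [Real.tanh_eq_sinh_div_cosh] at hα hβ
  rw [Real.tanh_eq_sinh_div_cosh] at hβ
  refine ⟨1 / (2 * Real.cosh K ^ 2 * Real.sinh L * Real.cosh L), by positivity, ?_, ?_, ?_⟩ <;>
    rw [hα, hβ] <;> simp only [Real.sinh_two_mul, Real.cosh_two_mul] <;> field_simp
  linear_combination Real.sinh K * hL2

lemma Dmat_mul_DmatInv_of_couplings {K L α β : ℝ} (hK : 0 < K) (hKL : K < L)
    (hα : α = Real.tanh K * (Real.cosh L / Real.sinh L)) (hβ : β = Real.tanh K * Real.tanh L)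
    (hγ_nonneg : ∀ x, 0 ≤ γ x)
    (hγ : ∀ x, Real.cosh (γ x) = Real.cosh (2 * K) * Real.cosh (2 * L) -
      Real.sinh (2 * K) * Real.sinh (2 * L) * Real.cos x) (n : ℕ) (l : ℤ) :
    Dmat (n + 1) l α β * DmatInv (n + 1) l γ = 1 := by
  have hL : 0 < L := hK.trans hKL
  have hsK : 0 < Real.sinh (2 * K) := Real.sinh_pos_iff.2 (by positivity)
  have hsL : 0 < Real.sinh (2 * L) := Real.sinh_pos_iff.2 (by positivity)
  have hcK : 0 < Real.cosh (2 * K) := Real.cosh_pos _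
  have hcL : 0 < Real.cosh (2 * L) := Real.cosh_pos _
  have hK2 := Real.cosh_sq (2 * K)
  have hL2 := Real.cosh_sq (2 * L)
  have hpos : ∀ x, 0 < γ x := fun x => by
    refine lt_of_le_of_ne (hγ_nonneg x) fun h0 => ?_
    have h1 : 1 < Real.cosh (2 * L - 2 * K) := Real.one_lt_cosh.2 (by linarith)
    have h2 := hγ x
    rw [← h0, Real.cosh_zero] at h2
    rw [Real.cosh_sub] at h1
    nlinarith [mul_pos hsK hsL, Real.cos_le_one x]
  have hs : ∀ x, 0 < Real.sinh (γ x) := fun x => Real.sinh_pos_iff.2 (hpos x)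
  set W : ℝ → ℝ := fun x => Real.cosh (2 * K) * Real.sinh (2 * L) +
    -(Real.sinh (2 * K) * Real.cosh (2 * L)) * Real.cos x with hWdef
  set V : ℝ → ℝ := fun x => -Real.sinh (2 * K) * Real.sin x with hVdef
  have hW : ∀ x, 0 < W x := fun x => by
    have h1 : 0 < Real.sinh (2 * L - 2 * K) := Real.sinh_pos_iff.2 (by linarith)
    rw [Real.sinh_sub] at h1
    simp only [hWdef]
    nlinarith [mul_pos hsK hcL, Real.cos_le_one x]
  have hWV : ∀ x, W x ^ 2 + V x ^ 2 = Real.sinh (γ x) ^ 2 := fun x => by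
    have h1 := Real.cosh_sq (γ x)
    rw [hγ] at h1
    have h2 := Real.sin_sq_add_cos_sq x
    simp only [hWdef, hVdef]
    linear_combination h1 + (Real.sinh (2 * K) ^ 2 * Real.cos x ^ 2 - Real.cosh (2 * K) ^ 2) * hL2 +
      Real.sinh (2 * K) ^ 2 * h2 - hK2
  set p : ℝ → ℝ := fun x => Real.sqrt ((1 + W x / Real.sinh (γ x)) / 2) with hpdef
  set q : ℝ → ℝ := fun x => V x / (2 * p x * Real.sinh (γ x)) with hqdef
  have key := fun x => half_angle_identities (hs x) (hW x) (hWV x) (p := p x) (q := q x) rfl rfl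
  have hp := fun x => (key x).1
  have hγc := continuous_gamma hγ hγ_nonneg
  have hWc : Continuous W := by fun_prop
  have hpc : Continuous p := by
    refine Real.continuous_sqrt.comp (Continuous.div_const (continuous_const.add ?_) 2)
    exact hWc.div (by fun_prop) fun x => (hs x).ne'
  have hqc : Continuous q := by
    refine Continuous.div (by fun_prop) (by fun_prop) fun x => ?_
    exact mul_ne_zero (mul_ne_zero two_ne_zero (hp x).ne') (hs x).ne'
  have hγ0 : γ 0 = 2 * L - 2 * K := by
    refine Real.cosh_strictMonoOn.injOn (hγ_nonneg 0) (Set.mem_Ici.2 (by linarith)) ?_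
    rw [hγ, Real.cosh_sub, Real.cos_zero]
    ring
  have hγpi : γ Real.pi = 2 * L + 2 * K := by
    refine Real.cosh_strictMonoOn.injOn (hγ_nonneg _) (Set.mem_Ici.2 (by linarith)) ?_
    rw [hγ, Real.cosh_add, Real.cos_pi]
    ring
  have hends : ∀ x, Real.sinh ((γ x + γ 0) / 2) * Real.sinh ((γ x + γ Real.pi) / 2) =
      Real.sqrt (Real.sinh (2 * L)) ^ 2 * Real.sinh (γ x) * p x ^ 2 := fun x => by
    have h := sinh_half_add_mul_sinh_half_sub (γ 0) (-γ Real.pi) (γ x)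
    rw [sub_neg_eq_add, sub_neg_eq_add] at h
    have e1 : (γ 0 + γ Real.pi) / 2 = 2 * L := by rw [hγ0, hγpi]; ring
    have e2 : (γ 0 + -γ Real.pi) / 2 = -(2 * K) := by rw [hγ0, hγpi]; ring
    rw [h, e1, e2, Real.cosh_neg, (key x).2.1, Real.sq_sqrt hsL.le, hγ]
    have := (hs x).ne'
    simp only [hWdef]
    field_simp
    linear_combination Real.cosh (2 * K) * hL2
  obtain ⟨ρ, hρ, hadd, hsum, hdiff⟩ := coupling_identities hL hα hβ
  have hsqb : ∀ x, sqb α β x = p x + q x * Complex.I := fun x => by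
    obtain ⟨h0, -, h1, h2, h3⟩ := key x
    refine sqb_eq hρ (hs x) h0 h1 (by rw [h2]; exact hW x) ?_ ?_
    · rw [h2, hadd, hsum]
      simp only [hWdef]
      ring
    · rw [h3, hdiff]
      simp only [hVdef]
      ring
  exact Dmat_mul_DmatInv hγ hpos (fun x => (key x).2.2.2.1) (fun x => (key x).2.2.2.2)
    (fun x => (key x).2.2.1) (Real.sqrt_pos.2 hsL) hp (mul_pos hsK hsL).ne' hends hpc hqc hsqb n l

end Dispersion

theorem inverse_of_D
    (N : ℕ) (hN : 1 ≤ N) (l : ℤ) (Kx Ky Kxs : ℝ)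
    (hKx : 0 < Kx) (hKy : 0 < Ky)
    (hKxs_pos : 0 < Kxs) (hKxs : Real.tanh Kxs = Real.exp (-(2 * Kx)))
    (α β : ℝ)
    (hα : α = Real.tanh Kxs * (Real.cosh Ky / Real.sinh Ky))
    (hβ : β = Real.tanh Kxs * Real.tanh Ky)
    (hferro : Kxs < Ky)
    (γ : ℝ → ℝ) (hγ_nonneg : ∀ θ, 0 ≤ γ θ)
    (hγ : ∀ θ, Real.cosh (γ θ) =
      Real.cosh (2 * Kxs) * Real.cosh (2 * Ky) -
        Real.sinh (2 * Kxs) * Real.sinh (2 * Ky) * Real.cos θ) :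
    IsUnit (Dmat N l α β).det ∧
      ∀ j k : Fin N,
        (Dmat N l α β)⁻¹ j k =
          Complex.I *
              Complex.exp (-Complex.I * ((l : ℂ) - 2⁻¹) *
                ((thetaA N j : ℝ) - (thetaP N k : ℝ))) *
              ((Real.exp ((nufun N γ (thetaA N j) - nufun N γ (thetaP N k)) / 2) : ℝ) : ℂ) /
              ((N : ℂ) *
                ((Real.sqrt (Real.sinh (γ (thetaA N j)) * Real.sinh (γ (thetaP N k))) : ℝ) : ℂ)) *
              ((Real.sinh ((γ (thetaA N j) + γ (thetaP N k)) / 2) : ℝ) : ℂ) /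
              Complex.sin ((((thetaA N j : ℝ) : ℂ) - (thetaP N k : ℝ)) / 2) := by
  obtain ⟨n, rfl⟩ := Nat.exists_eq_succ_of_ne_zero (Nat.one_le_iff_ne_zero.1 hN)
  have h := Dmat_mul_DmatInv_of_couplings hKxs_pos hferro hα hβ hγ_nonneg hγ n l
  refine ⟨Matrix.isUnit_det_of_right_inverse h, fun j k => ?_⟩
  rw [Matrix.inv_eq_right_inv h]
  rfl
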